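/- There exist constants C_{a,b} > 0 (a, b ∈ ℕ) and a smooth function m₊ : ℝ × (1,∞) → ℂ such that for every ξ > 1: the function f(x) := e^{ixξ} m₊(x,ξ) satisfies −f''(x) + (2/(1+x²)) f(x) = ξ² f(x) for all x ∈ ℝ; m₊(x,ξ) → 1 as x → +∞; and for all x > 0 and all a, b ∈ ℕ one has |(⟨x⟩∂ₓ)^a (ξ∂_ξ)^b (m₊(x,ξ) − 1)| ≤ C_{a,b} ξ^{−1} ⟨x⟩^{−1}. -/

import Mathlib

noncomputable section

open MeasureTheory Complex Filter

/-- Japanese bracket `⟨x⟩ = (1+x²)^{1/2}`. -/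
def jap (x : ℝ) : ℝ := Real.sqrt (1 + x ^ 2)

/-- The operator `g ↦ ⟨x⟩ ∂ₓ g` acting in the first variable. -/
def DX (F : ℝ → ℝ → ℂ) : ℝ → ℝ → ℂ := fun x ξ => (jap x : ℂ) * deriv (fun y => F y ξ) x

/-- The operator `g ↦ ξ ∂_ξ g` acting in the second variable. -/
def DXI (F : ℝ → ℝ → ℂ) : ℝ → ℝ → ℂ := fun x ξ => (ξ : ℂ) * deriv (fun η => F x η) ξ

open Set Metric Topology

/-- The differential of a function of two variables in terms of its partial derivatives. -/
lemma clm_prod_eq (L : ℂ × ℂ →L[ℂ] ℂ) :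
    L = L (1, 0) • ContinuousLinearMap.fst ℂ ℂ ℂ + L (0, 1) • ContinuousLinearMap.snd ℂ ℂ ℂ := by
  ext <;> simp

/-- Holomorphy of an integral of holomorphic functions of two variables, under local domination. -/
lemma differentiableOn_integral_of_dominated {α : Type*} [MeasurableSpace α] {μ : Measure α}
    {Ω : Set (ℂ × ℂ)} (hΩ : IsOpen Ω) {F : α → ℂ × ℂ → ℂ}
    (hF : ∀ᵐ a ∂μ, DifferentiableOn ℂ (F a) Ω)
    (hm : ∀ p ∈ Ω, AEStronglyMeasurable (fun a => F a p) μ)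
    (hb : ∀ p ∈ Ω, ∃ U ∈ 𝓝 p, ∃ bound : α → ℝ, Integrable bound μ ∧
      ∀ᵐ a ∂μ, ∀ q ∈ U, ‖F a q‖ ≤ bound a) :
    DifferentiableOn ℂ (fun p => ∫ a, F a p ∂μ) Ω := by
  intro p hp
  obtain ⟨U, hU, bound, hbi, hbd⟩ := hb p hp
  obtain ⟨r, hr, hrU⟩ := Metric.mem_nhds_iff.1 (Filter.inter_mem hU (hΩ.mem_nhds hp))
  have hmeas : ∀ v : ℂ × ℂ, AEStronglyMeasurable (fun a => fderiv ℂ (F a) p v) μ := by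
    intro v
    have hlim : Tendsto (fun n : ℕ => ((n : ℂ) + 1)⁻¹) atTop (𝓝[≠] 0) := by
      refine tendsto_nhdsWithin_iff.2 ⟨?_, Eventually.of_forall fun n => ?_⟩
      · simpa using (tendsto_one_div_add_atTop_nhds_zero_nat (𝕜 := ℂ))
      · exact inv_ne_zero (Nat.cast_add_one_ne_zero n)
    have hlim0 : Tendsto (fun n : ℕ => ((n : ℂ) + 1)⁻¹) atTop (𝓝 0) :=
      hlim.mono_right nhdsWithin_le_nhds
    have hmem : ∀ᶠ n : ℕ in atTop, p + ((n : ℂ) + 1)⁻¹ • v ∈ Ω := by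
      have : Tendsto (fun n : ℕ => p + ((n : ℂ) + 1)⁻¹ • v) atTop (𝓝 p) := by
        simpa using tendsto_const_nhds.add (hlim0.smul_const v)
      exact this (hΩ.mem_nhds hp)
    obtain ⟨N, hN⟩ := eventually_atTop.1 hmem
    refine aestronglyMeasurable_of_tendsto_ae (u := atTop)
      (f := fun (n : ℕ) a => (((n + N : ℕ) : ℂ) + 1) *
        (F a (p + (((n + N : ℕ) : ℂ) + 1)⁻¹ • v) - F a p)) (fun n => ?_) ?_
    · exact ((hm _ (hN _ (by simp))).sub (hm p hp)).const_mul _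
    · filter_upwards [hF] with a ha
      have h1 := ((ha p hp).differentiableAt (hΩ.mem_nhds hp)).hasFDerivAt.hasLineDerivAt v
      have h2 := h1.tendsto_slope_zero.comp (hlim.comp (tendsto_add_atTop_nat N))
      refine h2.congr fun n => ?_
      simp
  have hmeas' : AEStronglyMeasurable (fun a => fderiv ℂ (F a) p) μ := by
    have : (fun a => fderiv ℂ (F a) p) = fun a =>
        fderiv ℂ (F a) p (1, 0) • ContinuousLinearMap.fst ℂ ℂ ℂ +
        fderiv ℂ (F a) p (0, 1) • ContinuousLinearMap.snd ℂ ℂ ℂ :=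
      funext fun a => clm_prod_eq _
    rw [this]
    exact ((hmeas _).smul_const _).add ((hmeas _).smul_const _)
  refine (hasFDerivAt_integral_of_dominated_loc_of_lip' (ball_mem_nhds p hr)
    (fun q hq => hm q (hrU hq).2) (hbi.mono' (hm p hp) ?_) hmeas'
    (bound := fun a => 2 * bound a / r) ?_ ((hbi.const_mul 2).div_const r)
    ?_).2.differentiableAt.differentiableWithinAt
  · filter_upwards [hbd] with a ha using ha p (mem_of_mem_nhds hU)
  · filter_upwards [hbd, hF] with a ha hFa q hq
    have h := Complex.dist_le_div_mul_dist_of_mapsTo_ball (R₂ := 2 * bound a)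
      (hFa.mono fun x hx => (hrU hx).2) (fun x hx => ?_) hq
    · simpa [dist_eq_norm] using h
    · rw [mem_closedBall, dist_eq_norm]
      have h1 := ha x (hrU hx).1
      have h2 := ha p (mem_of_mem_nhds hU)
      linarith [norm_sub_le (F a x) (F a p)]
  · filter_upwards [hF] with a ha
    exact ((ha p hp).differentiableAt (hΩ.mem_nhds hp)).hasFDerivAt

lemma differentiableOn_fderiv_apply {Ω : Set (ℂ × ℂ)} (hΩ : IsOpen Ω) {F : ℂ × ℂ → ℂ}
    (hF : DifferentiableOn ℂ F Ω) (v : ℂ × ℂ) :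
    DifferentiableOn ℂ (fun p => fderiv ℂ F p v) Ω := by
  intro p hp
  have hc : ContinuousAt F p := hF.continuousOn.continuousAt (hΩ.mem_nhds hp)
  have hbd : ∀ᶠ q in 𝓝 p, ‖F q‖ < ‖F p‖ + 1 :=
    hc.norm.eventually (gt_mem_nhds (lt_add_one _))
  obtain ⟨r, hr, hrU⟩ := Metric.mem_nhds_iff.1 (Filter.inter_mem hbd (hΩ.mem_nhds hp))
  obtain ⟨ρ, hρ, hρr⟩ : ∃ ρ > 0, ρ * ‖v‖ < r / 2 := by
    refine ⟨r / 2 / (‖v‖ + 1), by positivity, ?_⟩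
    rw [div_mul_eq_mul_div, div_lt_iff₀ (by positivity)]
    nlinarith [norm_nonneg v]
  have hmem : ∀ q ∈ ball p (r / 2), ∀ z : ℂ, ‖z‖ ≤ ρ → q + z • v ∈ ball p r := by
    intro q hq z hz
    rw [mem_ball, dist_eq_norm] at hq ⊢
    have h1 : ‖z • v‖ ≤ ρ * ‖v‖ := by rw [norm_smul]; gcongr
    calc ‖q + z • v - p‖ = ‖(q - p) + z • v‖ := by congr 1; abel
      _ ≤ ‖q - p‖ + ‖z • v‖ := norm_add_le _ _
      _ < r := by linarith
  have key : ∀ q ∈ ball p (r / 2), fderiv ℂ F q v = ∫ θ in Ioc 0 (2 * Real.pi),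
      (2 * Real.pi * I : ℂ)⁻¹ • deriv (circleMap 0 ρ) θ • ((1 / (circleMap 0 ρ θ - 0) ^ 2) •
        F (q + circleMap 0 ρ θ • v)) := by
    intro q hq
    have hd : DifferentiableAt ℂ F q :=
      (hF q (hrU (by simpa using hmem q hq 0 (by simpa using hρ.le))).2).differentiableAt
        (hΩ.mem_nhds (hrU (by simpa using hmem q hq 0 (by simpa using hρ.le))).2)
    have h1 : deriv (fun z : ℂ => F (q + z • v)) 0 = fderiv ℂ F q v :=
      (hd.hasFDerivAt.hasLineDerivAt v).deriv
    have h2 : DiffContOnCl ℂ (fun z : ℂ => F (q + z • v)) (ball 0 ρ) := by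
      apply DifferentiableOn.diffContOnCl
      rw [closure_ball _ hρ.ne']
      refine hF.comp (by fun_prop) fun z hz => (hrU (hmem q hq z (by simpa using hz))).2
    have h3 := h2.deriv_eq_smul_circleIntegral hρ
    rw [← h1, integral_smul, ← intervalIntegral.integral_of_le (by positivity)]
    rw [circleIntegral] at h3
    rw [h3, inv_smul_smul₀ (by simp [Real.pi_ne_zero])]
  have hD : DifferentiableOn ℂ (fun q => ∫ θ in Ioc 0 (2 * Real.pi),
      (2 * Real.pi * I : ℂ)⁻¹ • deriv (circleMap 0 ρ) θ • ((1 / (circleMap 0 ρ θ - 0) ^ 2) •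
        F (q + circleMap 0 ρ θ • v))) (ball p (r / 2)) := by
    have hn : ∀ θ : ℝ, ‖circleMap 0 ρ θ‖ ≤ ρ := fun θ => by simp [abs_of_pos hρ]
    have hne : ∀ θ : ℝ, circleMap 0 ρ θ ≠ 0 := fun θ => circleMap_ne_center hρ.ne'
    refine differentiableOn_integral_of_dominated isOpen_ball ?_ ?_ ?_
    · refine Eventually.of_forall fun θ => ?_
      have := hF.comp (f := fun q : ℂ × ℂ => q + circleMap 0 ρ θ • v)
        (by fun_prop) fun q hq => (hrU (hmem q hq _ (hn θ))).2
      exact ((this.fun_const_smul (_ : ℂ)).fun_const_smul (_ : ℂ)).fun_const_smul (_ : ℂ)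
    · intro q hq
      refine Continuous.aestronglyMeasurable ?_
      have hc1 : Continuous fun θ : ℝ => F (q + circleMap 0 ρ θ • v) :=
        hF.continuousOn.comp_continuous (by fun_prop) fun θ => (hrU (hmem q hq _ (hn θ))).2
      have hc2 : Continuous fun θ : ℝ => 1 / (circleMap 0 ρ θ - 0) ^ 2 :=
        continuous_const.div (by fun_prop) fun θ => by simpa using hne θ
      simp only [deriv_circleMap, smul_eq_mul]
      exact continuous_const.mul (((continuous_circleMap 0 ρ).mul_const I).mul (hc2.mul hc1))
    · intro q hq
      refine ⟨ball p (r / 2), isOpen_ball.mem_nhds hq,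
        fun _ => ‖(2 * Real.pi * I : ℂ)⁻¹‖ * (ρ * (1 / ρ ^ 2 * (‖F p‖ + 1))),
        integrable_const _, Eventually.of_forall fun θ q' hq' => ?_⟩
      have h3 : ‖F (q' + circleMap 0 ρ θ • v)‖ ≤ ‖F p‖ + 1 := (hrU (hmem q' hq' _ (hn θ))).1.le
      simp only [norm_smul, norm_div, norm_pow, norm_one, deriv_circleMap, sub_zero,
        norm_circleMap_zero, norm_mul, norm_I, mul_one, abs_of_pos hρ]
      gcongr
  exact ((hD.congr key).differentiableAt
    (ball_mem_nhds p (half_pos hr))).differentiableWithinAt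

lemma contDiffOn_of_differentiableOn_prod {Ω : Set (ℂ × ℂ)} (hΩ : IsOpen Ω) {F : ℂ × ℂ → ℂ}
    (hF : DifferentiableOn ℂ F Ω) : ContDiffOn ℂ (⊤ : ℕ∞) F Ω := by
  rw [contDiffOn_infty]
  intro n
  induction n generalizing F with
  | zero => simpa using hF.continuousOn
  | succ n ih =>
    push_cast
    rw [contDiffOn_succ_iff_fderiv_of_isOpen hΩ]
    refine ⟨hF, by simp, ?_⟩
    rw [show fderiv ℂ F = fun p => fderiv ℂ F p (1, 0) • ContinuousLinearMap.fst ℂ ℂ ℂ +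
      fderiv ℂ F p (0, 1) • ContinuousLinearMap.snd ℂ ℂ ℂ from funext fun p => clm_prod_eq _]
    exact ((ih (differentiableOn_fderiv_apply hΩ hF _)).smul contDiffOn_const).add
      ((ih (differentiableOn_fderiv_apply hΩ hF _)).smul contDiffOn_const)

/-- Translation of the first variable by a real number. -/
def shiftFst (s : ℝ) (p : ℂ × ℂ) : ℂ × ℂ := (p.1 + s, p.2)

/-- A complex neighbourhood of `{(z, ξ) ∈ ℝ² : ξ > 0}`, stable under translations to the right and
conic over the quadrant `z > 0`. -/
def jostDom : Set (ℂ × ℂ) :=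
  {p | |p.2.im| < p.2.re / 2 ∧ |p.1.im| < (p.2.re + max p.1.re 0) / 2}

/-- The potential in the rescaled variable `z = x ξ`. -/
def jostPot (p : ℂ × ℂ) : ℂ := 2 / (p.2 ^ 2 + p.1 ^ 2)

/-- The Volterra kernel of the operator `∂² + 2i∂`. -/
def jostKer (s : ℝ) : ℂ := (Complex.exp (2 * I * s) - 1) / (2 * I)

/-- The integral `∫_t^∞ 8 / (ρ² + τ²) dτ`. -/
def jostPhi (ρ t : ℝ) : ℝ := 8 / ρ * (Real.pi / 2 - Real.arctan (t / ρ))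

/-- The integrand of the Volterra operator. -/
def volterraIntegrand (H : ℂ × ℂ → ℂ) (s : ℝ) (p : ℂ × ℂ) : ℂ :=
  jostKer s * (jostPot (shiftFst s p) * H (shiftFst s p))

/-- The Volterra operator inverting `∂² + 2i∂` on potential times `H`. -/
def volterra (H : ℂ × ℂ → ℂ) (p : ℂ × ℂ) : ℂ := ∫ s in Ioi (0 : ℝ), volterraIntegrand H s p

lemma isOpen_jostDom : IsOpen jostDom := by
  have h1 : Continuous fun p : ℂ × ℂ => p.1.re := by fun_prop
  have h2 : Continuous fun p : ℂ × ℂ => p.2.re := by fun_prop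
  exact (isOpen_lt (by fun_prop : Continuous fun p : ℂ × ℂ => |p.2.im|) (h2.div_const 2)).inter
    (isOpen_lt (by fun_prop : Continuous fun p : ℂ × ℂ => |p.1.im|)
      ((h2.add (h1.max continuous_const)).div_const 2))

lemma re_snd_pos_of_mem_jostDom {p : ℂ × ℂ} (hp : p ∈ jostDom) : 0 < p.2.re := by
  have := hp.1
  linarith [abs_nonneg p.2.im]

lemma shiftFst_mem_jostDom {p : ℂ × ℂ} (hp : p ∈ jostDom) {s : ℝ} (hs : 0 ≤ s) :
    shiftFst s p ∈ jostDom := by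
  refine ⟨hp.1, ?_⟩
  have h := hp.2
  have h1 : max p.1.re 0 ≤ max (p.1.re + s) 0 := max_le_max (by linarith) le_rfl
  simp only [shiftFst, add_im, ofReal_im, add_zero, add_re, ofReal_re]
  linarith

lemma re_sq_add_sq_ge {p : ℂ × ℂ} (hp : p ∈ jostDom) :
    (p.2.re ^ 2 + p.1.re ^ 2) / 4 ≤ (p.2 ^ 2 + p.1 ^ 2).re := by
  have hpos := re_snd_pos_of_mem_jostDom hp
  have h1 : p.2.im ^ 2 ≤ (p.2.re / 2) ^ 2 := by
    rw [← sq_abs]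
    gcongr
    exact hp.1.le
  have h2 : p.1.im ^ 2 ≤ ((p.2.re + |p.1.re|) / 2) ^ 2 := by
    rw [← sq_abs p.1.im]
    gcongr
    refine hp.2.le.trans ?_
    gcongr
    exact max_le (le_abs_self _) (abs_nonneg _)
  have h3 : (p.2 ^ 2 + p.1 ^ 2).re = p.2.re ^ 2 - p.2.im ^ 2 + (p.1.re ^ 2 - p.1.im ^ 2) := by
    simp [sq]
  rw [h3]
  nlinarith [sq_abs p.1.re, sq_nonneg (p.2.re - |p.1.re|)]

lemma sq_add_sq_ne_zero {p : ℂ × ℂ} (hp : p ∈ jostDom) : p.2 ^ 2 + p.1 ^ 2 ≠ 0 := by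
  intro h
  have h1 := re_sq_add_sq_ge hp
  rw [h, zero_re] at h1
  have := re_snd_pos_of_mem_jostDom hp
  nlinarith [sq_nonneg p.1.re]

lemma norm_jostPot_le {p : ℂ × ℂ} (hp : p ∈ jostDom) :
    ‖jostPot p‖ ≤ 8 / (p.2.re ^ 2 + p.1.re ^ 2) := by
  have hpos := re_snd_pos_of_mem_jostDom hp
  have h : (p.2.re ^ 2 + p.1.re ^ 2) / 4 ≤ ‖p.2 ^ 2 + p.1 ^ 2‖ :=
    (re_sq_add_sq_ge hp).trans (Complex.re_le_norm _)
  rw [jostPot, norm_div, div_le_div_iff₀ (lt_of_lt_of_le (by positivity) h) (by positivity)]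
  simp only [Complex.norm_ofNat]
  linarith

lemma differentiableOn_jostPot : DifferentiableOn ℂ jostPot jostDom := fun p hp => by
  have h' : DifferentiableAt ℂ (fun p : ℂ × ℂ => 2 / (p.2 ^ 2 + p.1 ^ 2)) p := by
    fun_prop (disch := exact sq_add_sq_ne_zero hp)
  exact h'.differentiableWithinAt

lemma norm_jostKer_le (s : ℝ) : ‖jostKer s‖ ≤ 1 := by
  have h : ‖Complex.exp (2 * I * s)‖ = 1 := by
    rw [show 2 * I * (s : ℂ) = ((2 * s : ℝ) : ℂ) * I by push_cast; ring, norm_exp_ofReal_mul_I]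
  rw [jostKer, norm_div, div_le_one (by simp)]
  refine (norm_sub_le _ _).trans ?_
  simp [h]
  norm_num

lemma continuous_jostKer : Continuous jostKer := by
  unfold jostKer
  fun_prop

lemma jostPhi_nonneg {ρ : ℝ} (hρ : 0 < ρ) (t : ℝ) : 0 ≤ jostPhi ρ t := by
  have := Real.arctan_lt_pi_div_two (t / ρ)
  have : 0 ≤ Real.pi / 2 - Real.arctan (t / ρ) := by linarith
  unfold jostPhi
  positivity

lemma jostPhi_le {ρ : ℝ} (hρ : 0 < ρ) (t : ℝ) : jostPhi ρ t ≤ 8 / ρ * Real.pi := by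
  have := Real.neg_pi_div_two_lt_arctan (t / ρ)
  unfold jostPhi
  gcongr
  linarith

lemma jostPhi_le_of_pos {ρ t : ℝ} (hρ : 0 < ρ) (ht : 0 < ρ + t) :
    jostPhi ρ t ≤ 16 * Real.pi / (ρ + t) := by
  rcases le_or_gt t ρ with h | h
  · refine (jostPhi_le hρ t).trans ?_
    rw [div_mul_eq_mul_div, div_le_div_iff₀ hρ ht]
    nlinarith [Real.pi_pos]
  · have ht0 : 0 < t := hρ.trans h
    have h1 : Real.pi / 2 - Real.arctan (t / ρ) = Real.arctan (ρ / t) := by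
      rw [← Real.arctan_inv_of_pos (by positivity), inv_div]
    have h2 : Real.arctan (ρ / t) ≤ ρ / t := by
      have h3 : 0 < ρ / t := by positivity
      have h4 := Real.lt_tan (Real.arctan_pos.2 h3) (Real.arctan_lt_pi_div_two _)
      rw [Real.tan_arctan] at h4
      exact h4.le
    calc jostPhi ρ t ≤ 8 / ρ * (ρ / t) := by
          unfold jostPhi
          rw [h1]
          gcongr
      _ = 8 / t := by field_simp
      _ ≤ 16 * Real.pi / (ρ + t) := by
          rw [div_le_div_iff₀ ht0 ht]
          nlinarith [Real.pi_gt_three]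

lemma hasDerivAt_exp_jostPhi {ρ : ℝ} (hρ : 0 < ρ) (t s : ℝ) :
    HasDerivAt (fun s => -(Real.exp (2 * jostPhi ρ (t + s)) / 2))
      (8 / (ρ ^ 2 + (t + s) ^ 2) * Real.exp (2 * jostPhi ρ (t + s))) s := by
  have h0 : HasDerivAt (fun s : ℝ => (t + s) / ρ) (1 / ρ) s :=
    ((hasDerivAt_id s).const_add t).div_const ρ
  have h1 := (((h0.arctan.const_sub (Real.pi / 2)).const_mul (8 / ρ)).const_mul 2).exp
  refine (h1.div_const 2).neg.congr_deriv ?_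
  unfold jostPhi
  field_simp

lemma tendsto_exp_jostPhi {ρ : ℝ} (hρ : 0 < ρ) (t : ℝ) :
    Tendsto (fun s => -(Real.exp (2 * jostPhi ρ (t + s)) / 2)) atTop (𝓝 (-(1 / 2))) := by
  have h1 : Tendsto (fun s : ℝ => (t + s) / ρ) atTop atTop :=
    (tendsto_atTop_add_const_left _ t tendsto_id).atTop_div_const hρ
  have h2 := (tendsto_nhds_of_tendsto_nhdsWithin Real.tendsto_arctan_atTop).comp h1
  have h3 := (((h2.const_sub (Real.pi / 2)).const_mul (8 / ρ)).const_mul 2).rexp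
  have h4 := (h3.div_const 2).neg
  simpa [jostPhi, Function.comp_def] using h4

lemma integrableOn_jost_weight {ρ : ℝ} (hρ : 0 < ρ) (t : ℝ) :
    IntegrableOn (fun s => 8 / (ρ ^ 2 + (t + s) ^ 2) * Real.exp (2 * jostPhi ρ (t + s)))
      (Ioi 0) :=
  integrableOn_Ioi_deriv_of_nonneg' (fun s _ => hasDerivAt_exp_jostPhi hρ t s)
    (fun s _ => by positivity) (tendsto_exp_jostPhi hρ t)

lemma integral_jost_weight {ρ : ℝ} (hρ : 0 < ρ) (t : ℝ) :
    ∫ s in Ioi (0 : ℝ), 8 / (ρ ^ 2 + (t + s) ^ 2) * Real.exp (2 * jostPhi ρ (t + s)) =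
      (Real.exp (2 * jostPhi ρ t) - 1) / 2 := by
  rw [integral_Ioi_of_hasDerivAt_of_nonneg' (fun s _ => hasDerivAt_exp_jostPhi hρ t s)
    (fun s _ => by positivity) (tendsto_exp_jostPhi hρ t)]
  simp only [add_zero]
  ring

section Volterra

variable {H : ℂ × ℂ → ℂ} {M : ℝ}

lemma norm_volterraIntegrand_le
    (hM : ∀ p ∈ jostDom, ‖H p‖ ≤ M * Real.exp (2 * jostPhi p.2.re p.1.re))
    {p : ℂ × ℂ} (hp : p ∈ jostDom) {s : ℝ} (hs : 0 ≤ s) :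
    ‖volterraIntegrand H s p‖ ≤ M * (8 / (p.2.re ^ 2 + (p.1.re + s) ^ 2) *
      Real.exp (2 * jostPhi p.2.re (p.1.re + s))) := by
  have hps := shiftFst_mem_jostDom hp hs
  have h1 := norm_jostPot_le hps
  have h2 := hM _ hps
  simp only [shiftFst, add_re, ofReal_re] at h1 h2
  have h3 : ‖volterraIntegrand H s p‖ ≤ 1 * (8 / (p.2.re ^ 2 + (p.1.re + s) ^ 2) *
      (M * Real.exp (2 * jostPhi p.2.re (p.1.re + s)))) := by
    rw [volterraIntegrand, norm_mul, norm_mul]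
    gcongr
    · exact norm_jostKer_le s
    · exact h1
    · exact h2
  exact h3.trans_eq (by ring)

lemma continuousOn_volterraIntegrand (hH : DifferentiableOn ℂ H jostDom) {p : ℂ × ℂ}
    (hp : p ∈ jostDom) : ContinuousOn (fun s => volterraIntegrand H s p) (Ici 0) := by
  have hsh : ContinuousOn (fun s => shiftFst s p) (Ici 0) := by
    unfold shiftFst
    fun_prop
  have hmaps : MapsTo (fun s => shiftFst s p) (Ici 0) jostDom :=
    fun s hs => shiftFst_mem_jostDom hp hs
  exact continuous_jostKer.continuousOn.mul
    ((differentiableOn_jostPot.continuousOn.comp hsh hmaps).mul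
      (hH.continuousOn.comp hsh hmaps))

lemma integrableOn_volterraIntegrand (hH : DifferentiableOn ℂ H jostDom)
    (hM : ∀ p ∈ jostDom, ‖H p‖ ≤ M * Real.exp (2 * jostPhi p.2.re p.1.re))
    {p : ℂ × ℂ} (hp : p ∈ jostDom) :
    IntegrableOn (fun s => volterraIntegrand H s p) (Ioi 0) := by
  refine ((integrableOn_jost_weight (re_snd_pos_of_mem_jostDom hp) p.1.re).const_mul M).mono'
    (((continuousOn_volterraIntegrand hH hp).mono Ioi_subset_Ici_self).aestronglyMeasurable
      measurableSet_Ioi) ?_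
  filter_upwards [ae_restrict_mem measurableSet_Ioi] with s hs
  exact norm_volterraIntegrand_le hM hp hs.le

lemma integral_norm_volterraIntegrand_le (hH : DifferentiableOn ℂ H jostDom)
    (hM : ∀ p ∈ jostDom, ‖H p‖ ≤ M * Real.exp (2 * jostPhi p.2.re p.1.re))
    {p : ℂ × ℂ} (hp : p ∈ jostDom) :
    ∫ s in Ioi (0 : ℝ), ‖volterraIntegrand H s p‖ ≤
      M * ((Real.exp (2 * jostPhi p.2.re p.1.re) - 1) / 2) := by
  rw [← integral_jost_weight (re_snd_pos_of_mem_jostDom hp) p.1.re, ← integral_const_mul]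
  refine setIntegral_mono_on (integrableOn_volterraIntegrand hH hM hp).norm
    ((integrableOn_jost_weight (re_snd_pos_of_mem_jostDom hp) p.1.re).const_mul M)
    measurableSet_Ioi fun s hs => norm_volterraIntegrand_le hM hp (le_of_lt hs)

lemma norm_volterra_le (hH : DifferentiableOn ℂ H jostDom)
    (hM : ∀ p ∈ jostDom, ‖H p‖ ≤ M * Real.exp (2 * jostPhi p.2.re p.1.re))
    {p : ℂ × ℂ} (hp : p ∈ jostDom) :
    ‖volterra H p‖ ≤ M * ((Real.exp (2 * jostPhi p.2.re p.1.re) - 1) / 2) :=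
  (norm_integral_le_integral_norm _).trans (integral_norm_volterraIntegrand_le hH hM hp)

lemma inv_sq_add_sq_le {ρ : ℝ} (hρ : 0 < ρ) (t s : ℝ) :
    1 / (ρ ^ 2 + (t + s) ^ 2) ≤ (2 + (1 + 2 * t ^ 2) / ρ ^ 2) * (1 + s ^ 2)⁻¹ := by
  rw [← div_eq_mul_inv, div_le_div_iff₀ (by positivity) (by positivity)]
  have h1 : (2 + (1 + 2 * t ^ 2) / ρ ^ 2) * (ρ ^ 2 + (t + s) ^ 2) =
      2 * (ρ ^ 2 + (t + s) ^ 2) + (1 + 2 * t ^ 2) +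
        (1 + 2 * t ^ 2) / ρ ^ 2 * (t + s) ^ 2 := by
    field_simp
    ring
  have h2 : 0 ≤ (1 + 2 * t ^ 2) / ρ ^ 2 * (t + s) ^ 2 := by positivity
  rw [h1]
  nlinarith [sq_nonneg (2 * t + s), sq_nonneg ρ]

lemma differentiableOn_volterra (hH : DifferentiableOn ℂ H jostDom) (hM0 : 0 ≤ M)
    (hM : ∀ p ∈ jostDom, ‖H p‖ ≤ M * Real.exp (2 * jostPhi p.2.re p.1.re)) :
    DifferentiableOn ℂ (volterra H) jostDom := by
  refine differentiableOn_integral_of_dominated isOpen_jostDom ?_ (fun p hp => ?_) fun p hp => ?_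
  · filter_upwards [ae_restrict_mem measurableSet_Ioi] with s hs
    have hsh : DifferentiableOn ℂ (shiftFst s) jostDom := by
      unfold shiftFst
      fun_prop
    have hmaps : MapsTo (shiftFst s) jostDom jostDom :=
      fun p hp => shiftFst_mem_jostDom hp (le_of_lt hs)
    exact ((differentiableOn_jostPot.comp hsh hmaps).mul (hH.comp hsh hmaps)).const_mul _
  · exact (integrableOn_volterraIntegrand hH hM hp).aestronglyMeasurable
  · have hρ := re_snd_pos_of_mem_jostDom hp
    let B : ℂ × ℂ → ℝ := fun q => M * (8 * (2 + (1 + 2 * q.1.re ^ 2) / q.2.re ^ 2) *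
      Real.exp (2 * (8 / q.2.re * Real.pi)))
    have hB : ContinuousAt B p := by
      have : p.2.re ≠ 0 := hρ.ne'
      have : p.2.re ^ 2 ≠ 0 := by positivity
      fun_prop (disch := assumption)
    refine ⟨{q | B q < B p + 1} ∩ jostDom,
      Filter.inter_mem (hB.eventually (gt_mem_nhds (lt_add_one _))) (isOpen_jostDom.mem_nhds hp),
      fun s => (B p + 1) * (1 + s ^ 2)⁻¹,
      (integrable_inv_one_add_sq.const_mul _).integrableOn, ?_⟩
    filter_upwards [ae_restrict_mem measurableSet_Ioi] with s hs q hq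
    have hqρ := re_snd_pos_of_mem_jostDom hq.2
    refine (norm_volterraIntegrand_le hM hq.2 (le_of_lt hs)).trans ?_
    have h1 := inv_sq_add_sq_le hqρ q.1.re s
    have h2 := jostPhi_le hqρ (q.1.re + s)
    calc M * (8 / (q.2.re ^ 2 + (q.1.re + s) ^ 2) *
          Real.exp (2 * jostPhi q.2.re (q.1.re + s)))
        = M * (8 * (1 / (q.2.re ^ 2 + (q.1.re + s) ^ 2)) *
          Real.exp (2 * jostPhi q.2.re (q.1.re + s))) := by ring
      _ ≤ M * (8 * ((2 + (1 + 2 * q.1.re ^ 2) / q.2.re ^ 2) * (1 + s ^ 2)⁻¹) *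
          Real.exp (2 * (8 / q.2.re * Real.pi))) := by gcongr
      _ = B q * (1 + s ^ 2)⁻¹ := by simp only [B]; ring
      _ ≤ (B p + 1) * (1 + s ^ 2)⁻¹ := by
          gcongr
          exact hq.1.le

end Volterra

/-- The Picard iterates of the Volterra equation. -/
def jostIter : ℕ → ℂ × ℂ → ℂ
  | 0 => fun _ => 1
  | n + 1 => volterra (jostIter n)

/-- The Jost solution in the rescaled variable, without its oscillating factor. -/
def jostSol (p : ℂ × ℂ) : ℂ := ∑' n, jostIter n p

lemma jostIter_differentiableOn_and_norm_le (n : ℕ) :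
    DifferentiableOn ℂ (jostIter n) jostDom ∧
      ∀ p ∈ jostDom, ‖jostIter n p‖ ≤ (1 / 2) ^ n * Real.exp (2 * jostPhi p.2.re p.1.re) := by
  induction n with
  | zero =>
    refine ⟨differentiableOn_const _, fun p hp => ?_⟩
    have := jostPhi_nonneg (re_snd_pos_of_mem_jostDom hp) p.1.re
    simpa [jostIter] using this
  | succ n ih =>
    refine ⟨differentiableOn_volterra ih.1 (by positivity) ih.2, fun p hp => ?_⟩
    refine (norm_volterra_le ih.1 ih.2 hp).trans ?_
    rw [pow_succ]
    have : (0 : ℝ) ≤ (1 / 2) ^ n := by positivity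
    nlinarith

lemma norm_jostIter_succ_le (n : ℕ) {p : ℂ × ℂ} (hp : p ∈ jostDom) :
    ‖jostIter (n + 1) p‖ ≤ (Real.exp (2 * jostPhi p.2.re p.1.re) - 1) * (1 / 2 / 2 ^ n) := by
  obtain ⟨h1, h2⟩ := jostIter_differentiableOn_and_norm_le n
  refine (norm_volterra_le h1 h2 hp).trans_eq ?_
  rw [one_div_pow]
  ring

lemma summable_norm_jostIter {p : ℂ × ℂ} (hp : p ∈ jostDom) :
    Summable fun n => ‖jostIter n p‖ :=
  Summable.of_nonneg_of_le (fun _ => norm_nonneg _)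
    (fun n => (jostIter_differentiableOn_and_norm_le n).2 p hp)
    (summable_geometric_two.mul_right _)

lemma norm_jostSol_sub_one_le {p : ℂ × ℂ} (hp : p ∈ jostDom) :
    ‖jostSol p - 1‖ ≤ Real.exp (2 * jostPhi p.2.re p.1.re) - 1 := by
  have hs := (summable_norm_jostIter hp).of_norm
  have h1 : jostSol p - 1 = ∑' n, jostIter (n + 1) p := by
    rw [jostSol, hs.tsum_eq_zero_add]
    simp [jostIter]
  rw [h1]
  refine tsum_of_norm_bounded ?_ fun n => norm_jostIter_succ_le n hp
  simpa using (hasSum_geometric_two' 1).mul_left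
    (Real.exp (2 * jostPhi p.2.re p.1.re) - 1)

lemma norm_jostSol_le {p : ℂ × ℂ} (hp : p ∈ jostDom) :
    ‖jostSol p‖ ≤ 1 * Real.exp (2 * jostPhi p.2.re p.1.re) := by
  have h := norm_jostSol_sub_one_le hp
  have h1 := norm_add_le (jostSol p - 1) 1
  rw [sub_add_cancel, norm_one] at h1
  linarith

lemma differentiableOn_jostSol : DifferentiableOn ℂ jostSol jostDom := by
  have h : DifferentiableOn ℂ (fun p => ∫ n, jostIter n p ∂Measure.count) jostDom := by
    refine differentiableOn_integral_of_dominated isOpen_jostDom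
      (Eventually.of_forall fun n => (jostIter_differentiableOn_and_norm_le n).1)
      (fun p hp => .of_discrete) fun p hp => ?_
    have hρ := re_snd_pos_of_mem_jostDom hp
    let B : ℂ × ℂ → ℝ := fun q => Real.exp (2 * (8 / q.2.re * Real.pi))
    have hB : ContinuousAt B p := by
      have : p.2.re ≠ 0 := hρ.ne'
      fun_prop (disch := assumption)
    refine ⟨{q | B q < B p + 1} ∩ jostDom,
      Filter.inter_mem (hB.eventually (gt_mem_nhds (lt_add_one _))) (isOpen_jostDom.mem_nhds hp),
      fun n => (1 / 2) ^ n * (B p + 1), ?_, Eventually.of_forall fun n q hq => ?_⟩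
    · rw [integrable_count_iff]
      exact (summable_geometric_two.mul_right _).norm
    · refine ((jostIter_differentiableOn_and_norm_le n).2 q hq.2).trans ?_
      have h1 := jostPhi_le (re_snd_pos_of_mem_jostDom hq.2) q.1.re
      have h2 : Real.exp (2 * jostPhi q.2.re q.1.re) ≤ B q := by
        simp only [B]
        gcongr
      exact mul_le_mul_of_nonneg_left (h2.trans hq.1.le) (by positivity)
  refine h.congr fun p hp => ?_
  rw [integral_countable ((integrable_count_iff).2 (summable_norm_jostIter hp))]
  simp [jostSol]

lemma jostSol_eq {p : ℂ × ℂ} (hp : p ∈ jostDom) : jostSol p = 1 + volterra jostSol p := by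
  have hs := (summable_norm_jostIter hp).of_norm
  rw [jostSol, hs.tsum_eq_zero_add]
  simp only [jostIter]
  congr 1
  unfold volterra
  rw [integral_tsum_of_summable_integral_norm
    (fun n => integrableOn_volterraIntegrand (jostIter_differentiableOn_and_norm_le n).1
      (jostIter_differentiableOn_and_norm_le n).2 hp)]
  · refine setIntegral_congr_fun measurableSet_Ioi fun s hs => ?_
    simp only [volterraIntegrand, jostSol]
    rw [tsum_mul_left, tsum_mul_left]
  · refine Summable.of_nonneg_of_le (fun n => integral_nonneg fun _ => norm_nonneg _)
      (fun n => integral_norm_volterraIntegrand_le (jostIter_differentiableOn_and_norm_le n).1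
        (jostIter_differentiableOn_and_norm_le n).2 hp) (summable_geometric_two.mul_right _)

lemma hasDerivAt_integral_Ioi {f : ℝ → ℂ} (hf : Continuous f)
    (hi : ∀ a, IntegrableOn f (Ioi a)) (z : ℝ) :
    HasDerivAt (fun z => ∫ t in Ioi z, f t) (-f z) z := by
  have h : (fun z => ∫ t in Ioi z, f t) =
      fun z => (∫ t in Ioi (0 : ℝ), f t) - ∫ t in (0 : ℝ)..z, f t := by
    funext y
    rw [← intervalIntegral.integral_Ioi_sub_Ioi' (hi 0) (hi y)]
    ring
  rw [h]
  exact (hf.integral_hasStrictDerivAt 0 z).hasDerivAt.const_sub _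

lemma ofReal_mem_jostDom {ξ : ℝ} (hξ : 0 < ξ) (z : ℝ) : ((z : ℂ), (ξ : ℂ)) ∈ jostDom := by
  have := le_max_right z 0
  refine ⟨?_, ?_⟩ <;> simp only [ofReal_im, ofReal_re, abs_zero] <;> linarith

/-- The differential equation of the Jost solution on the real line, in first-order form. -/
lemma exists_hasDerivAt_jostSol {ξ : ℝ} (hξ : 0 < ξ) :
    ∃ w₁ : ℝ → ℂ, (∀ z, HasDerivAt (fun z : ℝ => jostSol (z, ξ)) (w₁ z) z) ∧
      ∀ z, HasDerivAt w₁ (-2 * I * w₁ z + jostPot (z, ξ) * jostSol (z, ξ)) z := by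
  let h : ℝ → ℂ := fun t => jostPot (t, ξ) * jostSol (t, ξ)
  have hmem := ofReal_mem_jostDom hξ
  have hhc : Continuous h := by
    have hc : Continuous fun t : ℝ => ((t : ℂ), (ξ : ℂ)) := by fun_prop
    exact (differentiableOn_jostPot.continuousOn.comp_continuous hc hmem).mul
      (differentiableOn_jostSol.continuousOn.comp_continuous hc hmem)
  have hhi : ∀ a, IntegrableOn h (Ioi a) := by
    intro a
    have h1 : IntegrableOn (fun s => h (a + s)) (Ioi 0) := by
      refine (integrableOn_jost_weight hξ a).mono' (by fun_prop) ?_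
      filter_upwards with s
      simp only [h, norm_mul]
      have h2 := norm_jostPot_le (hmem (a + s))
      have h3 := norm_jostSol_le (hmem (a + s))
      simp only [ofReal_re, one_mul] at h2 h3
      gcongr
    have h2 := (measurePreserving_add_left volume a).integrableOn_comp_preimage
      (measurableEmbedding_addLeft a) (f := h) (s := Ioi a)
    rw [preimage_const_add_Ioi, sub_self] at h2
    exact h2.1 h1
  let k : ℝ → ℂ := fun t => Complex.exp (2 * I * t) * h t
  have hkc : Continuous k := by fun_prop
  have hki : ∀ a, IntegrableOn k (Ioi a) := fun a => by
    refine (hhi a).norm.mono' (by fun_prop) (Eventually.of_forall fun t => ?_)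
    rw [norm_mul, show 2 * I * (t : ℂ) = ((2 * t : ℝ) : ℂ) * I by push_cast; ring,
      norm_exp_ofReal_mul_I, one_mul]
  have hform : ∀ z : ℝ, jostSol (z, ξ) = 1 + (2 * I)⁻¹ *
      (Complex.exp (-(2 * I * z)) * (∫ t in Ioi z, k t) - ∫ t in Ioi z, h t) := by
    intro z
    have h1 := (measurePreserving_add_left volume z).setIntegral_preimage_emb
      (measurableEmbedding_addLeft z)
      (fun t => (2 * I)⁻¹ * (Complex.exp (-(2 * I * z)) * k t - h t)) (Ioi z)
    rw [preimage_const_add_Ioi, sub_self] at h1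
    have h2 : ∫ t in Ioi z, (2 * I)⁻¹ * (Complex.exp (-(2 * I * z)) * k t - h t) = (2 * I)⁻¹ *
        (Complex.exp (-(2 * I * z)) * (∫ t in Ioi z, k t) - ∫ t in Ioi z, h t) := by
      rw [integral_const_mul, integral_sub ((hki z).const_mul _) (hhi z), integral_const_mul]
    rw [jostSol_eq (hmem z), ← h2, ← h1, volterra]
    congr 1
    refine setIntegral_congr_fun measurableSet_Ioi fun s _ => ?_
    simp only [volterraIntegrand, shiftFst, jostKer, k, h, ofReal_add]
    rw [← mul_assoc (Complex.exp _), ← Complex.exp_add,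
      show -(2 * I * (z : ℂ)) + 2 * I * (z + s) = 2 * I * s by ring]
    ring
  have hexp : ∀ z : ℝ, HasDerivAt (fun z : ℝ => Complex.exp (-(2 * I * z)))
      (Complex.exp (-(2 * I * z)) * (-(2 * I))) z := by
    intro z
    have h1 : HasDerivAt (fun z : ℝ => -(2 * I * (z : ℂ))) (-(2 * I)) z := by
      simpa using ((hasDerivAt_id z).ofReal_comp.const_mul (2 * I)).fun_neg
    exact h1.cexp
  have hek : ∀ z : ℝ, Complex.exp (-(2 * I * z)) * k z = h z := fun z => by
    simp only [k]
    rw [← mul_assoc, ← Complex.exp_add, neg_add_cancel, Complex.exp_zero, one_mul]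
  refine ⟨fun z => -(Complex.exp (-(2 * I * z)) * ∫ t in Ioi z, k t), fun z => ?_, fun z => ?_⟩
  · rw [show (fun z : ℝ => jostSol (z, ξ)) = _ from funext hform]
    refine (((((hexp z).mul (hasDerivAt_integral_Ioi hkc hki z)).sub
      (hasDerivAt_integral_Ioi hhc hhi z)).const_mul (2 * I)⁻¹).const_add 1).congr_deriv ?_
    rw [mul_neg (Complex.exp _) (k z), hek]
    have : (2 * I : ℂ) ≠ 0 := by simp
    field_simp
    ring
  · refine ((hexp z).mul (hasDerivAt_integral_Ioi hkc hki z)).neg.congr_deriv ?_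
    rw [mul_neg (Complex.exp _) (k z), hek]
    simp only [h]
    ring

lemma one_le_jap (x : ℝ) : 1 ≤ jap x := Real.one_le_sqrt.2 (by nlinarith [sq_nonneg x])

lemma jap_sq (x : ℝ) : jap x ^ 2 = 1 + x ^ 2 := Real.sq_sqrt (by positivity)

lemma abs_le_jap (x : ℝ) : |x| ≤ jap x := by
  have h := jap_sq x
  have h1 := one_le_jap x
  refine abs_le_of_sq_le_sq (by linarith) (by linarith)

lemma jap_le_one_add {x : ℝ} (hx : 0 < x) : jap x ≤ 1 + x :=
  Real.sqrt_le_iff.2 ⟨by linarith, by nlinarith⟩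

/-- The polydisc of relative size `δ` around `(x, ξ)`. -/
def symbolPolydisc (δ x ξ : ℝ) : Set (ℂ × ℂ) :=
  {q | ‖q.1 - x‖ < δ * jap x ∧ ‖q.2 - ξ‖ < δ * ξ}

/-- The union of the polydiscs of relative size `δ` around the points with `x > 0`, `ξ > 1`. -/
def symbolDom (δ : ℝ) : Set (ℂ × ℂ) := {q | ∃ x > 0, ∃ ξ > 1, q ∈ symbolPolydisc δ x ξ}

/-- The principal holomorphic extension of the Japanese bracket. -/
def complexJap (z : ℂ) : ℂ := (1 + z ^ 2) ^ (1 / 2 : ℂ)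

/-- The function `F` extends holomorphically to polydiscs of a fixed relative size around the points
`x > 0`, `ξ > 1`, where the extension is bounded by a multiple of `ξ⁻¹ ⟨x⟩⁻¹`. -/
def IsHolomorphicSymbol (F : ℝ → ℝ → ℂ) : Prop :=
  ∃ (δ : ℝ) (G : ℂ × ℂ → ℂ), 0 < δ ∧ δ ≤ 1 / 16 ∧ DifferentiableOn ℂ G (symbolDom δ) ∧
    (∃ C > 0, ∀ x > 0, ∀ ξ > 1, ∀ q ∈ symbolPolydisc δ x ξ, ‖G q‖ ≤ C * ξ⁻¹ * (jap x)⁻¹) ∧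
    ∀ x > 0, ∀ ξ > 1, F x ξ = G (x, ξ)

lemma isOpen_symbolDom (δ : ℝ) : IsOpen (symbolDom δ) := by
  have h : symbolDom δ = ⋃ x ∈ Ioi (0 : ℝ), ⋃ ξ ∈ Ioi (1 : ℝ), symbolPolydisc δ x ξ := by
    ext q
    simp [symbolDom]
  rw [h]
  refine isOpen_biUnion fun x _ => isOpen_biUnion fun ξ _ => ?_
  exact (isOpen_lt (by fun_prop : Continuous fun q : ℂ × ℂ => ‖q.1 - x‖) continuous_const).inter
    (isOpen_lt (by fun_prop : Continuous fun q : ℂ × ℂ => ‖q.2 - ξ‖) continuous_const)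

lemma symbolPolydisc_mono {δ δ' x ξ : ℝ} (h : δ ≤ δ') (hξ : 1 < ξ) :
    symbolPolydisc δ x ξ ⊆ symbolPolydisc δ' x ξ := by
  have := one_le_jap x
  exact fun q hq => ⟨hq.1.trans_le (by gcongr), hq.2.trans_le (by gcongr)⟩

lemma symbolDom_mono {δ δ' : ℝ} (h : δ ≤ δ') : symbolDom δ ⊆ symbolDom δ' :=
  fun _ ⟨x, hx, ξ, hξ, hq⟩ => ⟨x, hx, ξ, hξ, symbolPolydisc_mono h hξ hq⟩

lemma ofReal_mem_symbolPolydisc {δ x ξ : ℝ} (hδ : 0 < δ) (hξ : 1 < ξ) :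
    ((x : ℂ), (ξ : ℂ)) ∈ symbolPolydisc δ x ξ := by
  have := one_le_jap x
  refine ⟨?_, ?_⟩ <;> simp only [sub_self, norm_zero] <;> positivity

lemma re_one_add_sq_pos {δ x ξ : ℝ} (hδ : 0 < δ) (hδ' : δ ≤ 1 / 16) {q : ℂ × ℂ}
    (hq : q ∈ symbolPolydisc δ x ξ) : 0 < (1 + q.1 ^ 2).re := by
  have hJ := one_le_jap x
  have hJ2 := jap_sq x
  have h1 : ‖q.1 - x‖ ≤ jap x / 16 := hq.1.le.trans (by nlinarith)
  have h2 := (Complex.abs_re_le_norm _).trans h1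
  have h3 := (Complex.abs_im_le_norm _).trans h1
  simp only [sub_re, ofReal_re, sub_im, ofReal_im, sub_zero] at h2 h3
  have h4 : (1 + q.1 ^ 2).re = 1 + q.1.re ^ 2 - q.1.im ^ 2 := by simp [sq]; ring
  have h5 : q.1.im ^ 2 ≤ (jap x / 16) ^ 2 := by
    rw [← sq_abs]
    gcongr
  have h6 : |x * (q.1.re - x)| ≤ jap x * (jap x / 16) := by
    rw [abs_mul]
    have := abs_le_jap x
    gcongr
  have h7 := (abs_le.1 h6).1
  rw [h4]
  nlinarith [sq_nonneg (q.1.re - x)]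

lemma complexJap_ofReal (x : ℝ) : complexJap x = jap x := by
  rw [complexJap, jap, Real.sqrt_eq_rpow, Complex.ofReal_cpow (by positivity)]
  push_cast
  rfl

lemma norm_complexJap_le {δ x ξ : ℝ} (hδ' : δ ≤ 1 / 16) {q : ℂ × ℂ}
    (hq : q ∈ symbolPolydisc δ x ξ) : ‖complexJap q.1‖ ≤ 2 * jap x := by
  have hJ := one_le_jap x
  have hJ2 := jap_sq x
  have h1 : ‖q.1 - x‖ ≤ jap x / 16 := hq.1.le.trans (by nlinarith)
  have h2 : ‖q.1‖ ≤ jap x / 16 + jap x := by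
    have h3 := norm_add_le (q.1 - x) (x : ℂ)
    rw [sub_add_cancel, Complex.norm_real, Real.norm_eq_abs] at h3
    linarith [abs_le_jap x]
  have h4 : complexJap q.1 ^ 2 = 1 + q.1 ^ 2 := by
    simp [complexJap]
  have h5 : ‖complexJap q.1‖ ^ 2 ≤ (2 * jap x) ^ 2 := by
    rw [← norm_pow, h4]
    refine (norm_add_le _ _).trans ?_
    rw [norm_one, norm_pow]
    have : ‖q.1‖ ^ 2 ≤ (jap x / 16 + jap x) ^ 2 := by gcongr
    nlinarith
  exact le_of_sq_le_sq h5 (by linarith)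

lemma norm_fderiv_apply_le {Ω : Set (ℂ × ℂ)} (hΩ : IsOpen Ω) {G : ℂ × ℂ → ℂ}
    (hG : DifferentiableOn ℂ G Ω) {q v : ℂ × ℂ} {R B : ℝ} (hR : 0 < R)
    (hmem : ∀ h : ℂ, ‖h‖ ≤ R → q + h • v ∈ Ω) (hB : ∀ h : ℂ, ‖h‖ ≤ R → ‖G (q + h • v)‖ ≤ B) :
    ‖fderiv ℂ G q v‖ ≤ B / R := by
  have hq : q ∈ Ω := by simpa using hmem 0 (by simpa using hR.le)
  have hd := (hG q hq).differentiableAt (hΩ.mem_nhds hq)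
  have h1 : deriv (fun z : ℂ => G (q + z • v)) 0 = fderiv ℂ G q v :=
    (hd.hasFDerivAt.hasLineDerivAt v).deriv
  rw [← h1]
  refine Complex.norm_deriv_le_of_forall_mem_sphere_norm_le hR ?_ fun z hz => hB z ?_
  · apply DifferentiableOn.diffContOnCl
    rw [closure_ball _ hR.ne']
    exact hG.comp (f := fun z : ℂ => q + z • v) (by fun_prop) fun z hz => hmem z (by simpa using hz)
  · rw [mem_sphere_zero_iff_norm] at hz
    exact hz.le

namespace IsHolomorphicSymbol

lemma exists_norm_le {F : ℝ → ℝ → ℂ} (hF : IsHolomorphicSymbol F) :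
    ∃ C > 0, ∀ ξ : ℝ, 1 < ξ → ∀ x : ℝ, 0 < x → ‖F x ξ‖ ≤ C * ξ⁻¹ * (jap x)⁻¹ := by
  obtain ⟨δ, G, hδ, -, -, ⟨C, hC, hb⟩, hFG⟩ := hF
  refine ⟨C, hC, fun ξ hξ x hx => ?_⟩
  rw [hFG x hx ξ hξ]
  exact hb x hx ξ hξ _ (ofReal_mem_symbolPolydisc hδ hξ)

lemma dx {F : ℝ → ℝ → ℂ} (hF : IsHolomorphicSymbol F) : IsHolomorphicSymbol (DX F) := by
  obtain ⟨δ, G, hδ, hδ', hG, ⟨C, hC, hb⟩, hFG⟩ := hF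
  refine ⟨δ / 4, fun q => complexJap q.1 * fderiv ℂ G q (1, 0), by positivity, by linarith, ?_,
    ⟨8 * C / δ, by positivity, ?_⟩, ?_⟩
  · refine DifferentiableOn.mul (fun q hq => ?_) ((differentiableOn_fderiv_apply
      (isOpen_symbolDom δ) hG _).mono (symbolDom_mono (by linarith)))
    obtain ⟨x, -, ξ, -, hq⟩ := hq
    have h : 1 + q.1 ^ 2 ∈ slitPlane :=
      Or.inl (re_one_add_sq_pos (by positivity) (by linarith) hq)
    unfold complexJap
    exact (DifferentiableAt.cpow_const (f := fun q : ℂ × ℂ => 1 + q.1 ^ 2) (by fun_prop)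
      h).differentiableWithinAt
  · intro x hx ξ hξ q hq
    have hJ : 0 < jap x := by linarith [one_le_jap x]
    have hmem : ∀ h : ℂ, ‖h‖ ≤ δ / 4 * jap x → q + h • (1, 0) ∈ symbolPolydisc δ x ξ := by
      intro h hh
      have h2 : δ / 4 * ξ < δ * ξ := by gcongr; linarith
      refine ⟨?_, by simpa using hq.2.trans h2⟩
      have h1 := norm_add_le (q.1 - x) h
      have h3 := hq.1
      have h4 : 0 < δ * jap x := by positivity
      simp only [Prod.smul_mk, smul_eq_mul, mul_one, Prod.fst_add]
      rw [add_sub_right_comm]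
      linarith
    have hd := norm_fderiv_apply_le (isOpen_symbolDom δ) hG (q := q) (v := (1, 0))
      (R := δ / 4 * jap x) (by positivity) (fun h hh => ⟨x, hx, ξ, hξ, hmem h hh⟩)
      (fun h hh => hb x hx ξ hξ _ (hmem h hh))
    rw [norm_mul]
    calc ‖complexJap q.1‖ * ‖fderiv ℂ G q (1, 0)‖
        ≤ (2 * jap x) * (C * ξ⁻¹ * (jap x)⁻¹ / (δ / 4 * jap x)) := by
          gcongr
          exact norm_complexJap_le (by linarith) hq
      _ = 8 * C / δ * ξ⁻¹ * (jap x)⁻¹ := by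
          field_simp
          norm_num
  · intro x hx ξ hξ
    have hmem : ((x : ℂ), (ξ : ℂ)) ∈ symbolDom δ :=
      ⟨x, hx, ξ, hξ, ofReal_mem_symbolPolydisc hδ hξ⟩
    have hd := ((hG _ hmem).differentiableAt ((isOpen_symbolDom δ).mem_nhds hmem)).hasFDerivAt
    have h1 : HasDerivAt (fun y : ℝ => ((y : ℂ), (ξ : ℂ))) (1, 0) x :=
      (hasDerivAt_id x).ofReal_comp.prodMk (hasDerivAt_const x (ξ : ℂ))
    have h2 : HasDerivAt (fun y : ℝ => G (y, ξ)) (fderiv ℂ G (x, ξ) (1, 0)) x :=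
      by
      simpa using! (hd.restrictScalars ℝ).comp_hasDerivAt
        (f := fun y : ℝ => ((y : ℂ), (ξ : ℂ))) x h1
    have h3 : (fun y => F y ξ) =ᶠ[𝓝 x] fun y : ℝ => G (y, ξ) := by
      filter_upwards [lt_mem_nhds hx] with y hy using hFG y hy ξ hξ
    simp only [DX, complexJap_ofReal]
    rw [(h2.congr_of_eventuallyEq h3).deriv]

lemma dxi {F : ℝ → ℝ → ℂ} (hF : IsHolomorphicSymbol F) : IsHolomorphicSymbol (DXI F) := by
  obtain ⟨δ, G, hδ, hδ', hG, ⟨C, hC, hb⟩, hFG⟩ := hF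
  refine ⟨δ / 4, fun q => q.2 * fderiv ℂ G q (0, 1), by positivity, by linarith, ?_,
    ⟨8 * C / δ, by positivity, ?_⟩, ?_⟩
  · exact DifferentiableOn.mul (by fun_prop) ((differentiableOn_fderiv_apply
      (isOpen_symbolDom δ) hG _).mono (symbolDom_mono (by linarith)))
  · intro x hx ξ hξ q hq
    have hJ : 0 < jap x := by linarith [one_le_jap x]
    have hξ0 : 0 < ξ := by linarith
    have hmem : ∀ h : ℂ, ‖h‖ ≤ δ / 4 * ξ → q + h • (0, 1) ∈ symbolPolydisc δ x ξ := by
      intro h hh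
      have h2 : δ / 4 * jap x < δ * jap x := by gcongr; linarith
      refine ⟨by simpa using hq.1.trans h2, ?_⟩
      have h1 := norm_add_le (q.2 - ξ) h
      have h3 := hq.2
      have h4 : 0 < δ * ξ := by positivity
      simp only [Prod.smul_mk, smul_eq_mul, mul_one, Prod.snd_add]
      rw [add_sub_right_comm]
      linarith
    have hd := norm_fderiv_apply_le (isOpen_symbolDom δ) hG (q := q) (v := (0, 1))
      (R := δ / 4 * ξ) (by positivity) (fun h hh => ⟨x, hx, ξ, hξ, hmem h hh⟩)
      (fun h hh => hb x hx ξ hξ _ (hmem h hh))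
    have hq2 : ‖q.2‖ ≤ 2 * ξ := by
      have h1 := norm_add_le (q.2 - ξ) (ξ : ℂ)
      rw [sub_add_cancel, Complex.norm_real, Real.norm_of_nonneg hξ0.le] at h1
      nlinarith [hq.2]
    rw [norm_mul]
    calc ‖q.2‖ * ‖fderiv ℂ G q (0, 1)‖
        ≤ (2 * ξ) * (C * ξ⁻¹ * (jap x)⁻¹ / (δ / 4 * ξ)) := by gcongr
      _ = 8 * C / δ * ξ⁻¹ * (jap x)⁻¹ := by
          field_simp
          norm_num
  · intro x hx ξ hξ
    have hmem : ((x : ℂ), (ξ : ℂ)) ∈ symbolDom δ :=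
      ⟨x, hx, ξ, hξ, ofReal_mem_symbolPolydisc hδ hξ⟩
    have hd := ((hG _ hmem).differentiableAt ((isOpen_symbolDom δ).mem_nhds hmem)).hasFDerivAt
    have h1 : HasDerivAt (fun η : ℝ => ((x : ℂ), (η : ℂ))) (0, 1) ξ :=
      (hasDerivAt_const ξ (x : ℂ)).prodMk (hasDerivAt_id ξ).ofReal_comp
    have h2 : HasDerivAt (fun η : ℝ => G (x, η)) (fderiv ℂ G (x, ξ) (0, 1)) ξ :=
      by
      simpa using! (hd.restrictScalars ℝ).comp_hasDerivAt
        (f := fun η : ℝ => ((x : ℂ), (η : ℂ))) ξ h1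
    have h3 : (fun η => F x η) =ᶠ[𝓝 ξ] fun η : ℝ => G (x, η) := by
      filter_upwards [lt_mem_nhds hξ] with η hη using hFG x hx η hη
    simp only [DXI]
    rw [(h2.congr_of_eventuallyEq h3).deriv]

lemma iterate {F : ℝ → ℝ → ℂ} (hF : IsHolomorphicSymbol F) (a b : ℕ) :
    IsHolomorphicSymbol (DX^[a] (DXI^[b] F)) := by
  induction a with
  | zero =>
    induction b with
    | zero => exact hF
    | succ b ih =>
      rw [Function.iterate_zero, id, Function.iterate_succ_apply']
      exact ih.dxi
  | succ a ih =>
    rw [Function.iterate_succ_apply']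
    exact ih.dx

end IsHolomorphicSymbol

lemma mem_jostDom_of_mem_symbolPolydisc {x ξ : ℝ} (hx : 0 < x) (hξ : 1 < ξ) {q : ℂ × ℂ}
    (hq : q ∈ symbolPolydisc (1 / 16) x ξ) :
    (q.1 * q.2, q.2) ∈ jostDom ∧ ξ * jap x / 2 ≤ q.2.re + (q.1 * q.2).re := by
  have hJ := one_le_jap x
  have hJx := jap_le_one_add hx
  have hξ0 : 0 < ξ := by linarith
  have h1 : ‖q.1 - x‖ ≤ (1 + x) / 16 := hq.1.le.trans (by linarith)
  have h2 : ‖q.2 - ξ‖ ≤ ξ / 16 := hq.2.le.trans (by linarith)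
  have h3 : ‖q.2‖ ≤ ξ / 16 + ξ := by
    have h := norm_add_le (q.2 - ξ) (ξ : ℂ)
    rw [sub_add_cancel, Complex.norm_real, Real.norm_of_nonneg hξ0.le] at h
    linarith
  have h4 : ‖q.1 * q.2 - ((x * ξ : ℝ) : ℂ)‖ ≤ 9 / 64 * (ξ * (1 + x)) := by
    rw [show q.1 * q.2 - ((x * ξ : ℝ) : ℂ) = (q.1 - x) * q.2 + x * (q.2 - ξ) by push_cast; ring]
    refine (norm_add_le _ _).trans ?_
    rw [norm_mul, norm_mul, Complex.norm_real, Real.norm_of_nonneg hx.le]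
    have h5 : ‖q.1 - x‖ * ‖q.2‖ ≤ (1 + x) / 16 * (ξ / 16 + ξ) := by gcongr
    have h6 : x * ‖q.2 - ξ‖ ≤ x * (ξ / 16) := by gcongr
    nlinarith
  have h5 := abs_le.1 ((Complex.abs_re_le_norm _).trans h4)
  have h6 := (Complex.abs_im_le_norm _).trans h4
  have h7 := abs_le.1 ((Complex.abs_re_le_norm _).trans h2)
  have h8 := (Complex.abs_im_le_norm _).trans h2
  simp only [sub_re, ofReal_re, sub_im, ofReal_im, sub_zero] at h5 h6 h7 h8
  have h9 := le_max_left (q.1 * q.2).re 0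
  have h10 : 0 < ξ * x := by positivity
  have h11 : ξ * jap x ≤ ξ * (1 + x) := by gcongr
  refine ⟨⟨?_, ?_⟩, ?_⟩
  · simp only
    linarith
  · simp only
    nlinarith
  · nlinarith

lemma isHolomorphicSymbol_jostSol :
    IsHolomorphicSymbol fun x ξ => jostSol (((x * ξ : ℝ) : ℂ), (ξ : ℂ)) - 1 := by
  refine ⟨1 / 16, fun q => jostSol (q.1 * q.2, q.2) - 1, by norm_num, le_rfl, ?_,
    ⟨64 * Real.pi * Real.exp (64 * Real.pi), by positivity, ?_⟩, ?_⟩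
  · refine (differentiableOn_jostSol.comp (f := fun q : ℂ × ℂ => (q.1 * q.2, q.2)) (by fun_prop)
      ?_).sub_const 1
    rintro q ⟨x, hx, ξ, hξ, hq⟩
    exact (mem_jostDom_of_mem_symbolPolydisc hx hξ hq).1
  · intro x hx ξ hξ q hq
    obtain ⟨h1, h2⟩ := mem_jostDom_of_mem_symbolPolydisc hx hξ hq
    have hJ := one_le_jap x
    have hρ := re_snd_pos_of_mem_jostDom h1
    have hξJ : 1 ≤ ξ * jap x := by nlinarith
    have h3 := norm_jostSol_sub_one_le h1
    have h4 := jostPhi_le_of_pos hρ (t := (q.1 * q.2).re) (by simp only; linarith)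
    have h5 : 16 * Real.pi / (q.2.re + (q.1 * q.2).re) ≤ 16 * Real.pi / (ξ * jap x / 2) := by
      gcongr
    set u := 2 * jostPhi q.2.re (q.1 * q.2).re with hu
    have h6 : u ≤ 64 * Real.pi * ξ⁻¹ * (jap x)⁻¹ := by
      have : 64 * Real.pi * ξ⁻¹ * (jap x)⁻¹ = 2 * (16 * Real.pi / (ξ * jap x / 2)) := by
        field_simp
        norm_num
      linarith
    have h7 : u ≤ 64 * Real.pi := by
      refine h6.trans ?_
      rw [mul_assoc, ← mul_inv]
      exact mul_le_of_le_one_right (by positivity) (inv_le_one_of_one_le₀ hξJ)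
    have hu0 : 0 ≤ u := mul_nonneg zero_le_two (jostPhi_nonneg hρ _)
    have h8 : Real.exp u - 1 ≤ u * Real.exp u := by
      have h := Real.add_one_le_exp (-u)
      have h' : Real.exp (-u) * Real.exp u = 1 := by rw [← Real.exp_add]; simp
      nlinarith [Real.exp_pos u]
    calc ‖jostSol (q.1 * q.2, q.2) - 1‖ ≤ u * Real.exp u := h3.trans h8
      _ ≤ (64 * Real.pi * ξ⁻¹ * (jap x)⁻¹) * Real.exp (64 * Real.pi) := by gcongr
      _ = _ := by ring
  · intro x _ ξ _
    push_cast
    rfl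

lemma contDiffOn_jostSol : ContDiffOn ℝ (⊤ : ℕ∞)
    (fun p : ℝ × ℝ => jostSol (((p.1 * p.2 : ℝ) : ℂ), (p.2 : ℂ))) {p : ℝ × ℝ | 1 < p.2} := by
  have h := (contDiffOn_of_differentiableOn_prod isOpen_jostDom
    differentiableOn_jostSol).restrict_scalars ℝ
  refine h.comp (f := fun p : ℝ × ℝ => (((p.1 * p.2 : ℝ) : ℂ), (p.2 : ℂ))) ?_ fun p hp =>
    ofReal_mem_jostDom (zero_lt_one.trans hp) _
  exact ((Complex.ofRealCLM.contDiff.comp (contDiff_fst.mul contDiff_snd)).prodMk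
    (Complex.ofRealCLM.contDiff.comp contDiff_snd)).contDiffOn

lemma jostSol_schrodinger {ξ : ℝ} (hξ : 0 < ξ) (x : ℝ) :
    - deriv (deriv (fun y : ℝ =>
        Complex.exp (Complex.I * y * ξ) * jostSol (((y * ξ : ℝ) : ℂ), (ξ : ℂ)))) x
      + ((2 / (1 + x ^ 2) : ℝ) : ℂ) *
        (Complex.exp (Complex.I * x * ξ) * jostSol (((x * ξ : ℝ) : ℂ), (ξ : ℂ)))
      = ((ξ : ℂ)) ^ 2 *
        (Complex.exp (Complex.I * x * ξ) * jostSol (((x * ξ : ℝ) : ℂ), (ξ : ℂ))) := by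
  obtain ⟨w₁, hw, hw₁⟩ := exists_hasDerivAt_jostSol hξ
  have he : ∀ y : ℝ, HasDerivAt (fun y : ℝ => Complex.exp (I * y * ξ))
      (Complex.exp (I * y * ξ) * (I * ξ)) y := by
    intro y
    have h1 : HasDerivAt (fun y : ℝ => I * (y : ℂ) * ξ) (I * ξ) y := by
      simpa using ((hasDerivAt_id y).ofReal_comp.const_mul I).mul_const (ξ : ℂ)
    exact h1.cexp
  have hs : ∀ y : ℝ, HasDerivAt (fun y : ℝ => y * ξ) ξ y := fun y => by
    simpa using (hasDerivAt_id y).mul_const ξ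
  have hm : ∀ y : ℝ, HasDerivAt (fun y : ℝ => jostSol (((y * ξ : ℝ) : ℂ), (ξ : ℂ)))
      (ξ • w₁ (y * ξ)) y := fun y =>
    HasDerivAt.scomp (g₁ := fun z : ℝ => jostSol ((z : ℂ), (ξ : ℂ))) y (hw (y * ξ)) (hs y)
  have hm₁ : ∀ y : ℝ, HasDerivAt (fun y : ℝ => w₁ (y * ξ)) (ξ • (-2 * I * w₁ (y * ξ) +
      jostPot (((y * ξ : ℝ) : ℂ), ξ) * jostSol (((y * ξ : ℝ) : ℂ), ξ))) y :=
    fun y => (hw₁ (y * ξ)).scomp y (hs y)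
  have hd : deriv (fun y : ℝ =>
      Complex.exp (Complex.I * y * ξ) * jostSol (((y * ξ : ℝ) : ℂ), (ξ : ℂ))) = _ :=
    funext fun y => ((he y).mul (hm y)).deriv
  have hdd := (((he x).mul_const (I * ξ)).fun_mul (hm x)).fun_add
    ((he x).fun_mul ((hm₁ x).fun_const_smul ξ))
  rw [hd, hdd.deriv]
  have hpot : jostPot (((x * ξ : ℝ) : ℂ), ξ) = ((2 / (ξ ^ 2 * (1 + x ^ 2)) : ℝ) : ℂ) := by
    simp only [jostPot]
    push_cast
    congr 1
    ring
  have hpot' : ((2 / (1 + x ^ 2) : ℝ) : ℂ) =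
      (ξ : ℂ) ^ 2 * ((2 / (ξ ^ 2 * (1 + x ^ 2)) : ℝ) : ℂ) := by
    norm_cast
    field_simp
  rw [hpot, hpot']
  simp only [Complex.real_smul]
  ring_nf
  simp only [I_sq]
  ring

/-- the Jost solution `f₊(x,ξ) = e^{ixξ} m₊(x,ξ)` for large frequencies
`ξ > 1`, with `m₊ → 1` as `x → ∞` and symbol-type bounds on `m₊ - 1` for `x > 0`. -/
theorem jost_solution_large_xi :
    ∃ (C : ℕ → ℕ → ℝ) (m : ℝ → ℝ → ℂ),
      (∀ a b : ℕ, 0 < C a b) ∧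
      ContDiffOn ℝ (⊤ : ℕ∞) (fun p : ℝ × ℝ => m p.1 p.2) {p : ℝ × ℝ | 1 < p.2} ∧
      ∀ ξ : ℝ, 1 < ξ →
        (∀ x : ℝ,
          - deriv (deriv (fun y : ℝ => Complex.exp (Complex.I * y * ξ) * m y ξ)) x
            + ((2 / (1 + x ^ 2) : ℝ) : ℂ) * (Complex.exp (Complex.I * x * ξ) * m x ξ)
          = ((ξ : ℂ)) ^ 2 * (Complex.exp (Complex.I * x * ξ) * m x ξ)) ∧
        Tendsto (fun x : ℝ => m x ξ) atTop (nhds 1) ∧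
        (∀ a b : ℕ, ∀ x : ℝ, 0 < x →
          ‖(DX^[a] (DXI^[b] (fun x ξ => m x ξ - 1))) x ξ‖
            ≤ C a b * ξ⁻¹ * (jap x)⁻¹) := by
  choose C hC hb using fun a b => (isHolomorphicSymbol_jostSol.iterate a b).exists_norm_le
  refine ⟨C, fun x ξ => jostSol (((x * ξ : ℝ) : ℂ), (ξ : ℂ)), hC, contDiffOn_jostSol,
    fun ξ hξ => ⟨jostSol_schrodinger (zero_lt_one.trans hξ), ?_, fun a b => hb a b ξ hξ⟩⟩
  rw [tendsto_iff_norm_sub_tendsto_zero]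
  have hjap : Tendsto jap atTop atTop :=
    tendsto_atTop_mono (fun x => (le_abs_self x).trans (abs_le_jap x)) tendsto_id
  refine squeeze_zero' (Eventually.of_forall fun _ => norm_nonneg _) ?_
    (by simpa using hjap.inv_tendsto_atTop.const_mul (C 0 0 * ξ⁻¹))
  filter_upwards [eventually_gt_atTop 0] with x hx
  exact hb 0 0 ξ hξ x hx
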